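/- Let K be a Hopf algebra over ℂ with involutive antipode (S∘S = id). Define linear maps θ : K^{⊗5} → K^{⊗6} by θ(a⊗b⊗c⊗d⊗e) = a₁S(b) ⊗ a₂c ⊗ a₃d ⊗ a₄S(e₂) ⊗ a₅ ⊗ e₁ and θ' : K^{⊗6} → K^{⊗5} by θ'(a⊗b⊗c⊗d⊗e⊗f) = ε(d)·(e₄ ⊗ S(a)e₃ ⊗ S(e₂)b ⊗ S(e₁)c ⊗ f). Then θ'∘θ = id on K^{⊗5}; in particular θ is injective. -/

import Mathlib

open TensorProduct

variable (K : Type*) [Ring K] [HopfAlgebra ℂ K]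

/-- The threefold iterated comultiplication `x ↦ x₁ ⊗ x₂ ⊗ x₃`. -/
noncomputable def comul₃ : K →ₗ[ℂ] K ⊗[ℂ] (K ⊗[ℂ] K) :=
  LinearMap.lTensor K (Coalgebra.comul (R := ℂ)) ∘ₗ Coalgebra.comul (R := ℂ)

/-- The fourfold iterated comultiplication `x ↦ x₁ ⊗ x₂ ⊗ x₃ ⊗ x₄`. -/
noncomputable def comul₄ : K →ₗ[ℂ] K ⊗[ℂ] (K ⊗[ℂ] (K ⊗[ℂ] K)) :=
  LinearMap.lTensor K (comul₃ K) ∘ₗ Coalgebra.comul (R := ℂ)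

/-- The fivefold iterated comultiplication `x ↦ x₁ ⊗ x₂ ⊗ x₃ ⊗ x₄ ⊗ x₅`. -/
noncomputable def comul₅ : K →ₗ[ℂ] K ⊗[ℂ] (K ⊗[ℂ] (K ⊗[ℂ] (K ⊗[ℂ] K))) :=
  LinearMap.lTensor K (comul₄ K) ∘ₗ Coalgebra.comul (R := ℂ)

open Coalgebra HopfAlgebra

section

variable {K}

lemma exists_repr_nat (x : K) : Nonempty (Repr ℂ x ℕ) := by
  obtain ⟨S, hS⟩ := TensorProduct.exists_finset (comul (R := ℂ) x)
  let g : ℕ → K × K := fun i ↦ if h : i < S.card then (S.equivFin.symm ⟨i, h⟩ : K × K) else 0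
  refine ⟨⟨Finset.range S.card, fun i ↦ (g i).1, fun i ↦ (g i).2, ?_⟩⟩
  rw [hS, Finset.sum_range, ← Finset.sum_coe_sort S,
    ← S.equivFin.symm.sum_comp fun p ↦ (p : K × K).1 ⊗ₜ[ℂ] (p : K × K).2]
  simp [g]

/-- A presentation of `comul x` as a finite sum of pure tensors indexed by natural numbers. -/
noncomputable def natRepr (x : K) : Repr ℂ x ℕ := (exists_repr_nat x).some

lemma comul_eq_sum_natRepr (x : K) :
    comul (R := ℂ) x = ∑ i ∈ (natRepr x).index, (natRepr x).left i ⊗ₜ[ℂ] (natRepr x).right i :=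
  (natRepr x).eq.symm

lemma comul₃_eq_sum (x : K) :
    comul₃ K x = ∑ i ∈ (natRepr x).index,
      (natRepr x).left i ⊗ₜ[ℂ] comul (R := ℂ) ((natRepr x).right i) := by
  simp [comul₃, comul_eq_sum_natRepr x]

lemma comul₄_eq_sum (x : K) :
    comul₄ K x = ∑ i ∈ (natRepr x).index,
      (natRepr x).left i ⊗ₜ[ℂ] comul₃ K ((natRepr x).right i) := by
  simp [comul₄, comul_eq_sum_natRepr x]

lemma comul₅_eq_sum (x : K) :
    comul₅ K x = ∑ i ∈ (natRepr x).index,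
      (natRepr x).left i ⊗ₜ[ℂ] comul₄ K ((natRepr x).right i) := by
  simp [comul₅, comul_eq_sum_natRepr x]

/-- If `m (x₁ ⊗ x₂) = ε(x) d` for all `x`, then `m (x₁ ⊗ x₂) ⊗ Q x₃ = d ⊗ Q x`. -/
lemma map_assoc_symm_comul {N : Type*} [AddCommMonoid N] [Module ℂ N] (m : K ⊗[ℂ] K →ₗ[ℂ] K) (d : K)
    (hm : ∀ x, m (comul (R := ℂ) x) = counit (R := ℂ) x • d) (Q : K →ₗ[ℂ] N) (x : K) :
    TensorProduct.map m Q ((TensorProduct.assoc ℂ K K K).symm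
      ((comul (R := ℂ)).lTensor K (comul (R := ℂ) x))) = d ⊗ₜ[ℂ] Q x := by
  rw [coassoc_symm_apply, ← (natRepr x).eq]
  simp only [map_sum, LinearMap.rTensor_tmul, TensorProduct.map_tmul, hm, TensorProduct.smul_tmul,
    ← TensorProduct.tmul_sum, ← map_smul]
  rw [← map_sum, sum_counit_smul]

lemma sum_sum_tmul_eq {N : Type*} [AddCommMonoid N] [Module ℂ N] (m : K ⊗[ℂ] K →ₗ[ℂ] K) (d : K)
    (hm : ∀ x, m (comul (R := ℂ) x) = counit (R := ℂ) x • d) (Q : K →ₗ[ℂ] N) (x : K) :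
    ∑ i ∈ (natRepr x).index, ∑ j ∈ (natRepr ((natRepr x).right i)).index,
      m ((natRepr x).left i ⊗ₜ (natRepr ((natRepr x).right i)).left j) ⊗ₜ[ℂ]
        Q ((natRepr ((natRepr x).right i)).right j) = d ⊗ₜ[ℂ] Q x := by
  rw [← map_assoc_symm_comul m d hm Q x, comul_eq_sum_natRepr x]
  simp only [map_sum, LinearMap.lTensor_tmul]
  refine Finset.sum_congr rfl fun i _ ↦ ?_
  rw [comul_eq_sum_natRepr ((natRepr x).right i)]
  simp [TensorProduct.tmul_sum]

lemma sum_antipode_right_mul_left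
    (hS : ∀ x : K, antipode (R := ℂ) (antipode (R := ℂ) x) = x) (x : K) :
    ∑ i ∈ (natRepr x).index,
      antipode (R := ℂ) ((natRepr x).right i) * (natRepr x).left i = algebraMap ℂ K (counit x) := by
  have h := congrArg (antipode (R := ℂ)) (sum_antipode_mul_eq_algebraMap_counit (natRepr x))
  simpa [antipode_mul_antidistrib, hS, Algebra.algebraMap_eq_smul_one] using h

lemma sum_antipode_mul_left_mul {N : Type*} [AddCommMonoid N] [Module ℂ N]
    (hS : ∀ x : K, antipode (R := ℂ) (antipode (R := ℂ) x) = x) (d : K) (Q : K →ₗ[ℂ] N) (x : K) :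
    ∑ i ∈ (natRepr x).index, ∑ j ∈ (natRepr ((natRepr x).right i)).index,
      (antipode (R := ℂ) ((natRepr ((natRepr x).right i)).left j) * ((natRepr x).left i * d)) ⊗ₜ[ℂ]
        Q ((natRepr ((natRepr x).right i)).right j) = d ⊗ₜ[ℂ] Q x := by
  refine sum_sum_tmul_eq (LinearMap.mul' ℂ K ∘ₗ
    TensorProduct.map (antipode (R := ℂ)) (LinearMap.mulRight ℂ d) ∘ₗ
    (TensorProduct.comm ℂ K K).toLinearMap) d (fun y ↦ ?_) Q x
  rw [comul_eq_sum_natRepr y]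
  simp [← mul_assoc, ← Finset.sum_mul, sum_antipode_right_mul_left hS, Algebra.smul_def]

lemma sum_antipode_mul_antipode_mul
    (hS : ∀ x : K, antipode (R := ℂ) (antipode (R := ℂ) x) = x) (b x : K) :
    ∑ i ∈ (natRepr x).index, ∑ j ∈ (natRepr ((natRepr x).right i)).index,
      (antipode (R := ℂ) ((natRepr x).left i * antipode (R := ℂ) b) *
        (natRepr ((natRepr x).right i)).left j) ⊗ₜ[ℂ]
        (natRepr ((natRepr x).right i)).right j = b ⊗ₜ[ℂ] x := by
  refine sum_sum_tmul_eq (LinearMap.mul' ℂ K ∘ₗ LinearMap.rTensor K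
    (antipode (R := ℂ) ∘ₗ LinearMap.mulRight ℂ (antipode (R := ℂ) b))) b (fun y ↦ ?_) LinearMap.id x
  rw [comul_eq_sum_natRepr y]
  simp [antipode_mul_antidistrib, hS, mul_assoc, ← Finset.mul_sum,
    sum_antipode_mul_eq_algebraMap_counit, Algebra.algebraMap_eq_smul_one]

/-- The linear map `z₁ ⊗ z₂ ⊗ z₃ ⊗ z₄ ↦ z₄ ⊗ z₃ ⊗ z₂ ⊗ z₁ ⊗ e`. -/
noncomputable def reverseTmul (e : K) : K ⊗[ℂ] (K ⊗[ℂ] (K ⊗[ℂ] K)) →ₗ[ℂ]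
    K ⊗[ℂ] (K ⊗[ℂ] (K ⊗[ℂ] (K ⊗[ℂ] K))) :=
  let s₀ (N : Type _) [AddCommMonoid N] [Module ℂ N] :=
    (TensorProduct.leftComm ℂ K K N).toLinearMap
  let s₁ := (s₀ (K ⊗[ℂ] K)).lTensor K
  let s₂ := ((s₀ K).lTensor K).lTensor K
  s₀ _ ∘ₗ s₁ ∘ₗ s₀ _ ∘ₗ s₂ ∘ₗ s₁ ∘ₗ s₀ _ ∘ₗ
    (((TensorProduct.mk ℂ K K).flip e).lTensor K |>.lTensor K |>.lTensor K)

@[simp]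
lemma reverseTmul_tmul (e z₁ z₂ z₃ z₄ : K) :
    reverseTmul e (z₁ ⊗ₜ (z₂ ⊗ₜ (z₃ ⊗ₜ z₄))) = z₄ ⊗ₜ (z₃ ⊗ₜ (z₂ ⊗ₜ (z₁ ⊗ₜ e))) := by
  simp [reverseTmul]

/-- The linear map `x ↦ S(x₁)B ⊗ Q x₂`. -/
noncomputable def antipodeMulTmul {N : Type*} [AddCommMonoid N] [Module ℂ N] (B : K)
    (Q : K →ₗ[ℂ] N) : K →ₗ[ℂ] K ⊗[ℂ] N :=
  TensorProduct.map (LinearMap.mulRight ℂ B ∘ₗ antipode (R := ℂ)) Q ∘ₗ comul (R := ℂ)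

lemma antipodeMulTmul_apply {N : Type*} [AddCommMonoid N] [Module ℂ N] (B : K)
    (Q : K →ₗ[ℂ] N) (x : K) : antipodeMulTmul B Q x = ∑ i ∈ (natRepr x).index,
      (antipode (R := ℂ) ((natRepr x).left i) * B) ⊗ₜ[ℂ] Q ((natRepr x).right i) := by
  simp [antipodeMulTmul, comul_eq_sum_natRepr x]

/-- The linear map `x ↦ Ax₁ ⊗ x₂`. -/
noncomputable def mulLeftTmul (A : K) : K →ₗ[ℂ] K ⊗[ℂ] K :=
  (LinearMap.mulLeft ℂ A).rTensor K ∘ₗ comul (R := ℂ)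

lemma mulLeftTmul_apply (A x : K) : mulLeftTmul A x = ∑ i ∈ (natRepr x).index,
      (A * (natRepr x).left i) ⊗ₜ[ℂ] (natRepr x).right i := by
  simp [mulLeftTmul, comul_eq_sum_natRepr x]

lemma sum_antipodeMulTmul
    (hS : ∀ x : K, antipode (R := ℂ) (antipode (R := ℂ) x) = x) (a b c d : K) :
    ∑ i ∈ (natRepr a).index, ∑ j ∈ (natRepr ((natRepr a).right i)).index,
      ∑ k ∈ (natRepr ((natRepr ((natRepr a).right i)).right j)).index,
        antipodeMulTmul ((natRepr ((natRepr ((natRepr a).right i)).right j)).left k * d)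
          (antipodeMulTmul ((natRepr ((natRepr a).right i)).left j * c)
            (mulLeftTmul (antipode (R := ℂ) ((natRepr a).left i * antipode (R := ℂ) b))))
          ((natRepr ((natRepr ((natRepr a).right i)).right j)).right k) =
      d ⊗ₜ[ℂ] (c ⊗ₜ[ℂ] (b ⊗ₜ[ℂ] a)) := by
  simp only [antipodeMulTmul_apply _ (antipodeMulTmul _ _), sum_antipode_mul_left_mul hS]
  simp only [← TensorProduct.tmul_sum, antipodeMulTmul_apply, sum_antipode_mul_left_mul hS]
  simp only [mulLeftTmul_apply, sum_antipode_mul_antipode_mul hS]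

end

/-- Let `K` be a Hopf algebra over `ℂ` with involutive antipode.  Let `θ : K^⊗5 → K^⊗6`,
`θ(a⊗b⊗c⊗d⊗e) = a₁S(b) ⊗ a₂c ⊗ a₃d ⊗ a₄S(e₂) ⊗ a₅ ⊗ e₁`, and `θ' : K^⊗6 → K^⊗5`,
`θ'(a⊗b⊗c⊗d⊗e⊗f) = ε(d)·(e₄ ⊗ S(a)e₃ ⊗ S(e₂)b ⊗ S(e₁)c ⊗ f)` (stated via arbitrary
representations of the iterated comultiplications).  Then `θ' ∘ θ = id` on `K^⊗5`; in
particular `θ` is injective. -/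
theorem theta_retraction_five_six
    (hS : ∀ x : K, HopfAlgebra.antipode (R := ℂ) (HopfAlgebra.antipode (R := ℂ) x) = x)
    (θ : (K ⊗[ℂ] (K ⊗[ℂ] (K ⊗[ℂ] (K ⊗[ℂ] K)))) →ₗ[ℂ]
      (K ⊗[ℂ] (K ⊗[ℂ] (K ⊗[ℂ] (K ⊗[ℂ] (K ⊗[ℂ] K))))))
    (θ' : (K ⊗[ℂ] (K ⊗[ℂ] (K ⊗[ℂ] (K ⊗[ℂ] (K ⊗[ℂ] K))))) →ₗ[ℂ]
      (K ⊗[ℂ] (K ⊗[ℂ] (K ⊗[ℂ] (K ⊗[ℂ] K)))))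
    (hθ : ∀ (a b c d e : K) (ι κ : Type) (s : Finset ι) (t : Finset κ)
        (a₁ a₂ a₃ a₄ a₅ : ι → K) (e₁ e₂ : κ → K),
      comul₅ K a = ∑ i ∈ s, a₁ i ⊗ₜ[ℂ] (a₂ i ⊗ₜ[ℂ] (a₃ i ⊗ₜ[ℂ] (a₄ i ⊗ₜ[ℂ] a₅ i))) →
      Coalgebra.comul (R := ℂ) e = ∑ j ∈ t, e₁ j ⊗ₜ[ℂ] e₂ j →
      θ (a ⊗ₜ[ℂ] (b ⊗ₜ[ℂ] (c ⊗ₜ[ℂ] (d ⊗ₜ[ℂ] e)))) = ∑ i ∈ s, ∑ j ∈ t,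
        (a₁ i * HopfAlgebra.antipode (R := ℂ) b) ⊗ₜ[ℂ]
          ((a₂ i * c) ⊗ₜ[ℂ] ((a₃ i * d) ⊗ₜ[ℂ]
            ((a₄ i * HopfAlgebra.antipode (R := ℂ) (e₂ j)) ⊗ₜ[ℂ] (a₅ i ⊗ₜ[ℂ] e₁ j)))))
    (hθ' : ∀ (a b c d e f : K) (ι : Type) (s : Finset ι) (e₁ e₂ e₃ e₄ : ι → K),
      comul₄ K e = ∑ i ∈ s, e₁ i ⊗ₜ[ℂ] (e₂ i ⊗ₜ[ℂ] (e₃ i ⊗ₜ[ℂ] e₄ i)) →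
      θ' (a ⊗ₜ[ℂ] (b ⊗ₜ[ℂ] (c ⊗ₜ[ℂ] (d ⊗ₜ[ℂ] (e ⊗ₜ[ℂ] f))))) =
        Coalgebra.counit (R := ℂ) d • ∑ i ∈ s,
          e₄ i ⊗ₜ[ℂ] ((HopfAlgebra.antipode (R := ℂ) a * e₃ i) ⊗ₜ[ℂ]
            ((HopfAlgebra.antipode (R := ℂ) (e₂ i) * b) ⊗ₜ[ℂ]
              ((HopfAlgebra.antipode (R := ℂ) (e₁ i) * c) ⊗ₜ[ℂ] f)))) :
    (∀ u : K ⊗[ℂ] (K ⊗[ℂ] (K ⊗[ℂ] (K ⊗[ℂ] K))), θ' (θ u) = u) ∧ Function.Injective θ := by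
  have h₁ (A B C D E F : K) :
      θ' (A ⊗ₜ (B ⊗ₜ (C ⊗ₜ (D ⊗ₜ (E ⊗ₜ F))))) = counit (R := ℂ) D •
        reverseTmul F (antipodeMulTmul C (antipodeMulTmul B
          (mulLeftTmul (antipode (R := ℂ) A))) E) := by
    rw [hθ' A B C D E F (Σ _ : ℕ, Σ _ : ℕ, ℕ)
      ((natRepr E).index.sigma fun i ↦ (natRepr ((natRepr E).right i)).index.sigma fun j ↦
        (natRepr ((natRepr ((natRepr E).right i)).right j)).index)
      (fun p ↦ (natRepr E).left p.1)
      (fun p ↦ (natRepr ((natRepr E).right p.1)).left p.2.1)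
      (fun p ↦ (natRepr ((natRepr ((natRepr E).right p.1)).right p.2.1)).left p.2.2)
      (fun p ↦ (natRepr ((natRepr ((natRepr E).right p.1)).right p.2.1)).right p.2.2)]
    · simp [Finset.sum_sigma, antipodeMulTmul_apply, mulLeftTmul_apply, TensorProduct.tmul_sum]
    · simp [Finset.sum_sigma, comul₄_eq_sum, comul₃_eq_sum, comul_eq_sum_natRepr,
        TensorProduct.tmul_sum]
  have h₂ (A B C x e : K) :
      ∑ m ∈ (natRepr x).index, ∑ t ∈ (natRepr e).index,
        θ' (A ⊗ₜ (B ⊗ₜ (C ⊗ₜ (((natRepr x).left m * antipode (R := ℂ) ((natRepr e).right t)) ⊗ₜ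
          ((natRepr x).right m ⊗ₜ (natRepr e).left t))))) =
      reverseTmul e (antipodeMulTmul C (antipodeMulTmul B
          (mulLeftTmul (antipode (R := ℂ) A))) x) := by
    have hx := sum_counit_smul (natRepr x)
    have he : ∑ t ∈ (natRepr e).index,
        counit (R := ℂ) ((natRepr e).right t) • (natRepr e).left t = e := by
      simpa only [map_sum, TensorProduct.rid_tmul, one_smul] using
        congrArg (TensorProduct.rid ℂ K) (sum_tmul_counit_eq (natRepr e))
    have h₃ : θ' (A ⊗ₜ (B ⊗ₜ (C ⊗ₜ ((1 : K) ⊗ₜ (x ⊗ₜ e))))) =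
        reverseTmul e (antipodeMulTmul C (antipodeMulTmul B
          (mulLeftTmul (antipode (R := ℂ) A))) x) := by
      simp [h₁]
    have h₄ (D E F : K) : θ' (A ⊗ₜ (B ⊗ₜ (C ⊗ₜ (D ⊗ₜ (E ⊗ₜ F))))) = counit (R := ℂ) D •
        θ' (A ⊗ₜ (B ⊗ₜ (C ⊗ₜ ((1 : K) ⊗ₜ (E ⊗ₜ F))))) := by
      simp [h₁]
    rw [← h₃]
    conv_rhs => rw [← hx, ← he]
    simp only [TensorProduct.sum_tmul, TensorProduct.tmul_sum, TensorProduct.tmul_smul, map_sum,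
      ← TensorProduct.smul_tmul', map_smul,
      Finset.smul_sum]
    rw [Finset.sum_comm]
    refine Finset.sum_congr rfl fun t _ ↦ Finset.sum_congr rfl fun m _ ↦ ?_
    rw [h₄, Bialgebra.counit_mul, counit_antipode, mul_comm, mul_smul]
  have h (u : K ⊗[ℂ] (K ⊗[ℂ] (K ⊗[ℂ] (K ⊗[ℂ] K)))) : θ' (θ u) = u := by
    suffices H : θ' ∘ₗ θ = LinearMap.id from LinearMap.congr_fun H u
    ext a b c d e
    simp only [TensorProduct.AlgebraTensorModule.curry_apply, TensorProduct.curry_apply,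
      LinearMap.restrictScalars_self, LinearMap.comp_apply, LinearMap.id_apply]
    rw [hθ a b c d e (Σ _ : ℕ, Σ _ : ℕ, Σ _ : ℕ, ℕ) ℕ
      ((natRepr a).index.sigma fun i ↦ (natRepr ((natRepr a).right i)).index.sigma fun j ↦
        (natRepr ((natRepr ((natRepr a).right i)).right j)).index.sigma fun k ↦
          (natRepr ((natRepr ((natRepr ((natRepr a).right i)).right j)).right k)).index)
      (natRepr e).index
      (fun p ↦ (natRepr a).left p.1)
      (fun p ↦ (natRepr ((natRepr a).right p.1)).left p.2.1)
      (fun p ↦ (natRepr ((natRepr ((natRepr a).right p.1)).right p.2.1)).left p.2.2.1)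
      (fun p ↦ (natRepr ((natRepr ((natRepr ((natRepr a).right p.1)).right p.2.1)).right
        p.2.2.1)).left p.2.2.2)
      (fun p ↦ (natRepr ((natRepr ((natRepr ((natRepr a).right p.1)).right p.2.1)).right
        p.2.2.1)).right p.2.2.2)
      _ _ ?_ (comul_eq_sum_natRepr e)]
    · simp only [Finset.sum_sigma, map_sum, h₂]
      simp only [← map_sum, sum_antipodeMulTmul hS, reverseTmul_tmul]
    · simp [Finset.sum_sigma, comul₅_eq_sum, comul₄_eq_sum, comul₃_eq_sum, comul_eq_sum_natRepr,
        TensorProduct.tmul_sum]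
  exact ⟨h, Function.LeftInverse.injective h⟩
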